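/- Let θ be the Riemann theta function of an indecomposable principally polarized abelian variety, and set τ(x,t) = θ(Ux + Vt + Z). The function ψ(x,t) = (θ(A + Ux + Vt + Z)/θ(Ux + Vt + Z)) e^{px + Et} satisfies (∂_t − ∂_x² + u)ψ = 0 with u = −2∂_x² log τ, for all Z, if and only if for all half-integer characteristics ε ∈ ((1/2)ℤ/ℤ)^g the level-two theta constants satisfy (∂_V − ∂_U² − 2p ∂_U + (E − p²)) Θ[ε,0](A/2) = 0. -/

import Mathlib

open Complex

/-- The Riemann theta function `θ(z,B) = Σ_{m∈ℤ^g} e^{2πi(m,z)+πi(m,Bm)}`. -/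
noncomputable def riemannTheta (g : ℕ) (B : Matrix (Fin g) (Fin g) ℂ)
    (z : Fin g → ℂ) : ℂ :=
  ∑' m : Fin g → ℤ,
    Complex.exp (2 * Real.pi * I * (∑ i, (m i : ℂ) * z i)
      + Real.pi * I * (∑ i, ∑ j, (m i : ℂ) * B i j * (m j : ℂ)))

/-- The level two theta function with half-integer characteristic `ε`:
`Θ[ε,0](z) = θ[ε,0](2z, 2B) = Σ_{m∈ℤ^g} e^{2πi(m+ε, 2z) + 2πi(m+ε, B(m+ε))}`. -/
noncomputable def thetaLevel2 (g : ℕ) (B : Matrix (Fin g) (Fin g) ℂ)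
    (ε : Fin g → ℝ) (z : Fin g → ℂ) : ℂ :=
  ∑' m : Fin g → ℤ,
    Complex.exp (2 * Real.pi * I * (∑ i, ((m i : ℂ) + (ε i : ℂ)) * (2 * z i))
      + 2 * Real.pi * I * (∑ i, ∑ j, ((m i : ℂ) + (ε i : ℂ)) * B i j * ((m j : ℂ) + (ε j : ℂ))))

/-- Directional derivative along `U` of a function on `ℂ^g`. -/
noncomputable def dirD {g : ℕ} (U : Fin g → ℂ) (f : (Fin g → ℂ) → ℂ)
    (z : Fin g → ℂ) : ℂ :=
  deriv (fun s : ℂ => f (z + s • U)) 0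

/-- The general term `e^{2πi(v,z)+πi(v,Bv)}` of a theta series. -/
noncomputable def thetaTerm {g : ℕ} (B : Matrix (Fin g) (Fin g) ℂ) (v z : Fin g → ℂ) : ℂ :=
  exp (2 * Real.pi * I * (∑ i, v i * z i) + Real.pi * I * (∑ i, ∑ j, v i * B i j * v j))

/-- The theta series with real characteristic `[ε,0]`. -/
noncomputable def thetaChar {g : ℕ} (B : Matrix (Fin g) (Fin g) ℂ) (ε : Fin g → ℝ)
    (z : Fin g → ℂ) : ℂ :=
  ∑' m : Fin g → ℤ, thetaTerm B (fun i => (m i : ℂ) + ε i) z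

lemma riemannTheta_eq_thetaChar {g : ℕ} (B : Matrix (Fin g) (Fin g) ℂ) (z : Fin g → ℂ) :
    riemannTheta g B z = thetaChar B 0 z := by
  simp [riemannTheta, thetaChar, thetaTerm]

lemma thetaLevel2_eq_thetaChar {g : ℕ} (B : Matrix (Fin g) (Fin g) ℂ) (ε : Fin g → ℝ)
    (z : Fin g → ℂ) :
    thetaLevel2 g B ε z = thetaChar ((2 : ℝ) • B) ε ((2 : ℂ) • z) := by
  simp only [thetaLevel2, thetaChar, thetaTerm, Pi.smul_apply, smul_eq_mul, Matrix.smul_apply,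
    Complex.real_smul]
  refine tsum_congr fun m => ?_
  congr 2
  rw [mul_comm 2 (Real.pi : ℂ), mul_assoc, mul_assoc, mul_assoc]
  congr 1
  rw [mul_left_comm, Finset.mul_sum]
  congr 1
  refine Finset.sum_congr rfl fun i _ => ?_
  rw [Finset.mul_sum]
  refine Finset.sum_congr rfl fun j _ => ?_
  push_cast
  ring

/-- A positive definite real quadratic form dominates a multiple of the sum of squares. -/
lemma Matrix.PosDef.exists_pos_mul_sum_sq_le {g : ℕ} {Y : Matrix (Fin g) (Fin g) ℝ}
    (hY : Y.PosDef) :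
    ∃ δ > 0, ∀ y : Fin g → ℝ, δ * ∑ i, y i ^ 2 ≤ ∑ i, ∑ j, y i * Y i j * y j := by
  have hpos : ∀ y : Fin g → ℝ, y ≠ 0 → 0 < ∑ i, ∑ j, y i * Y i j * y j := by
    intro y hy
    have h := (Matrix.posDef_iff_dotProduct_mulVec.1 hY).2 hy
    simpa [dotProduct, Matrix.mulVec, Finset.mul_sum, mul_assoc] using h
  have hcont : Continuous fun y : Fin g → ℝ => ∑ i, ∑ j, y i * Y i j * y j := by fun_prop
  have hsq : Continuous fun y : Fin g → ℝ => ∑ i, y i ^ 2 := by fun_prop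
  have hK : IsCompact {y : Fin g → ℝ | ∑ i, y i ^ 2 = 1} := by
    refine Metric.isCompact_of_isClosed_isBounded (isClosed_eq hsq continuous_const) ?_
    refine (Metric.isBounded_iff_subset_closedBall 0).2 ⟨1, fun y hy => ?_⟩
    rw [mem_closedBall_zero_iff, pi_norm_le_iff_of_nonneg zero_le_one]
    intro i
    have : y i ^ 2 ≤ ∑ i, y i ^ 2 :=
      Finset.single_le_sum (f := fun i => y i ^ 2) (fun i _ => sq_nonneg _) (Finset.mem_univ i)
    rw [hy.out] at this
    rw [Real.norm_eq_abs]
    exact (sq_le_one_iff_abs_le_one _).1 this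
  obtain ⟨δ, hδ, hmin⟩ : ∃ δ > 0, ∀ y : Fin g → ℝ, ∑ i, y i ^ 2 = 1 →
      δ ≤ ∑ i, ∑ j, y i * Y i j * y j := by
    rcases Set.eq_empty_or_nonempty {y : Fin g → ℝ | ∑ i, y i ^ 2 = 1} with h | h
    · exact ⟨1, one_pos, fun y hy => (h.subset hy).elim⟩
    · obtain ⟨y₀, hy₀, hm⟩ := hK.exists_isMinOn h hcont.continuousOn
      refine ⟨_, hpos y₀ ?_, fun y hy => hm hy⟩
      rintro rfl
      simp at hy₀
  refine ⟨δ, hδ, fun y => ?_⟩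
  have hnn : 0 ≤ ∑ i, y i ^ 2 := Finset.sum_nonneg fun i _ => sq_nonneg _
  rcases hnn.eq_or_lt with h | h
  · have : y = 0 := by
      funext i
      have := (Finset.sum_eq_zero_iff_of_nonneg fun i _ => sq_nonneg (y i)).1 h.symm i
        (Finset.mem_univ i)
      simpa using this
    simp [this]
  · set r := Real.sqrt (∑ i, y i ^ 2) with hr
    have hr2 : r ^ 2 = ∑ i, y i ^ 2 := Real.sq_sqrt hnn
    have hr0 : 0 < r := Real.sqrt_pos.2 h
    have h1 := hmin (fun i => r⁻¹ * y i) (by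
      simp_rw [mul_pow, ← Finset.mul_sum, ← hr2]
      field_simp)
    have h2 : ∑ i, ∑ j, r⁻¹ * y i * Y i j * (r⁻¹ * y j)
        = (r ^ 2)⁻¹ * ∑ i, ∑ j, y i * Y i j * y j := by
      simp_rw [Finset.mul_sum]
      refine Finset.sum_congr rfl fun i _ => Finset.sum_congr rfl fun j _ => ?_
      field_simp
    rw [h2, ← div_eq_inv_mul, le_div_iff₀ (by positivity)] at h1
    rwa [← hr2]

/-- Products of a summable nonnegative function over the coordinates are summable. -/
lemma summable_prod_apply {ι : Type*} {f : ι → ℝ} (hf : Summable f) (hf0 : ∀ i, 0 ≤ f i) (g : ℕ) :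
    Summable fun m : Fin g → ι => ∏ i, f (m i) := by
  induction g with
  | zero => exact Summable.of_finite
  | succ n ih =>
    rw [← (Fin.consEquiv fun _ : Fin (n + 1) => ι).summable_iff]
    have := hf.mul_of_nonneg ih hf0 fun m => Finset.prod_nonneg fun i _ => hf0 _
    refine this.congr fun x => ?_
    simp [Fin.consEquiv, Fin.prod_univ_succ]

lemma summable_exp_neg_abs_int : Summable fun n : ℤ => Real.exp (-|(n : ℝ)|) := by
  have h : Summable fun n : ℕ => Real.exp (-(n : ℝ)) := Real.summable_exp_neg_nat
  refine Summable.of_nat_of_neg ?_ ?_ <;> simpa using h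

lemma norm_thetaTerm {g : ℕ} (B : Matrix (Fin g) (Fin g) ℂ) (y : Fin g → ℝ) (z : Fin g → ℂ) :
    ‖thetaTerm B (fun i => (y i : ℂ)) z‖
      = Real.exp (-(2 * Real.pi * ∑ i, y i * (z i).im)
          - Real.pi * ∑ i, ∑ j, y i * (B i j).im * y j) := by
  rw [thetaTerm, Complex.norm_exp]
  congr 1
  have h1 : (∑ i, (y i : ℂ) * z i).im = ∑ i, y i * (z i).im := by simp
  have h2 : (∑ i, ∑ j, (y i : ℂ) * B i j * (y j : ℂ)).im
      = ∑ i, ∑ j, y i * (B i j).im * y j := by simp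
  rw [← h1, ← h2]
  simp
  ring

/-- Theta series are dominated, uniformly for bounded arguments, by a summable series. -/
lemma exists_summable_bound_thetaTerm {g : ℕ} {B : Matrix (Fin g) (Fin g) ℂ}
    (hpos : Matrix.PosDef (Matrix.of fun i j => (B i j).im)) (ε : Fin g → ℝ) (R : ℝ) :
    ∃ u : (Fin g → ℤ) → ℝ, Summable u ∧ ∀ z : Fin g → ℂ, ‖z‖ ≤ R →
      ∀ m, ‖thetaTerm B (fun i => (m i : ℂ) + ε i) z‖ ≤ u m := by
  obtain ⟨δ, hδ, hY⟩ := hpos.exists_pos_mul_sum_sq_le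
  have hπ := Real.pi_pos
  set C : ℝ := (2 * Real.pi * R + 1) ^ 2 / (4 * (Real.pi * δ)) with hC
  have hquad : ∀ s : ℝ, 2 * Real.pi * R * s - Real.pi * δ * s ^ 2 ≤ C - s := by
    intro s
    have h0 : 0 < Real.pi * δ := by positivity
    have : C - s - (2 * Real.pi * R * s - Real.pi * δ * s ^ 2)
        = (2 * (Real.pi * δ) * s - (2 * Real.pi * R + 1)) ^ 2 / (4 * (Real.pi * δ)) := by
      rw [hC]; field_simp; ring
    have h2 : 0 ≤ (2 * (Real.pi * δ) * s - (2 * Real.pi * R + 1)) ^ 2 / (4 * (Real.pi * δ)) := by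
      positivity
    linarith
  refine ⟨fun m => ∏ i, (Real.exp (C + ‖ε‖) * Real.exp (-|(m i : ℝ)|)),
    summable_prod_apply (summable_exp_neg_abs_int.mul_left _) (fun _ => by positivity) g,
    fun z hz m => ?_⟩
  have hcast : (fun i => (m i : ℂ) + ε i) = fun i => (((m i : ℝ) + ε i : ℝ) : ℂ) := by
    funext i; push_cast; rfl
  rw [hcast, norm_thetaTerm]
  simp_rw [← Real.exp_add]
  rw [← Real.exp_sum, Real.exp_le_exp]
  have h1 := hY fun i => (m i : ℝ) + ε i
  simp only [Matrix.of_apply] at h1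
  have h2 : -(2 * Real.pi * ∑ i, ((m i : ℝ) + ε i) * (z i).im)
      ≤ ∑ i, 2 * Real.pi * R * |(m i : ℝ) + ε i| := by
    rw [Finset.mul_sum, ← Finset.sum_neg_distrib]
    refine Finset.sum_le_sum fun i _ => ?_
    have h3 : |((m i : ℝ) + ε i) * (z i).im| ≤ |(m i : ℝ) + ε i| * R := by
      rw [abs_mul]
      exact mul_le_mul_of_nonneg_left
        ((Complex.abs_im_le_norm _).trans ((norm_le_pi_norm z i).trans hz)) (abs_nonneg _)
    have h4 := neg_le_of_abs_le h3
    nlinarith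
  have h5 : ∀ i, 2 * Real.pi * R * |(m i : ℝ) + ε i| - Real.pi * δ * ((m i : ℝ) + ε i) ^ 2
      ≤ C + ‖ε‖ + -|(m i : ℝ)| := by
    intro i
    have h6 := hquad |(m i : ℝ) + ε i|
    rw [sq_abs] at h6
    have h7 : |ε i| ≤ ‖ε‖ := norm_le_pi_norm ε i
    have h8 : |(m i : ℝ)| ≤ |(m i : ℝ) + ε i| + |ε i| := by
      simpa using abs_sub ((m i : ℝ) + ε i) (ε i)
    linarith
  calc _ ≤ (∑ i, 2 * Real.pi * R * |(m i : ℝ) + ε i|)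
          - Real.pi * (δ * ∑ i, ((m i : ℝ) + ε i) ^ 2) := by
        have := mul_le_mul_of_nonneg_left h1 hπ.le
        linarith
    _ = ∑ i, (2 * Real.pi * R * |(m i : ℝ) + ε i| - Real.pi * δ * ((m i : ℝ) + ε i) ^ 2) := by
        rw [Finset.sum_sub_distrib, Finset.mul_sum, Finset.mul_sum]
        simp_rw [mul_assoc]
    _ ≤ _ := Finset.sum_le_sum fun i _ => h5 i

lemma summable_norm_thetaTerm {g : ℕ} {B : Matrix (Fin g) (Fin g) ℂ}
    (hpos : Matrix.PosDef (Matrix.of fun i j => (B i j).im)) (ε : Fin g → ℝ) (z : Fin g → ℂ) :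
    Summable fun m : Fin g → ℤ => ‖thetaTerm B (fun i => (m i : ℂ) + ε i) z‖ := by
  obtain ⟨u, hu, hle⟩ := exists_summable_bound_thetaTerm hpos ε ‖z‖
  exact Summable.of_nonneg_of_le (fun _ => norm_nonneg _) (hle z le_rfl) hu

/-- Theta functions are entire along complex lines. -/
lemma differentiable_thetaChar_line {g : ℕ} {B : Matrix (Fin g) (Fin g) ℂ}
    (hpos : Matrix.PosDef (Matrix.of fun i j => (B i j).im)) (ε : Fin g → ℝ) (z d : Fin g → ℂ) :
    Differentiable ℂ fun s : ℂ => thetaChar B ε (z + s • d) := by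
  intro s₀
  obtain ⟨u, hu, hle⟩ := exists_summable_bound_thetaTerm hpos ε (‖z‖ + (‖s₀‖ + 1) * ‖d‖)
  have : DifferentiableOn ℂ (fun s : ℂ => thetaChar B ε (z + s • d)) (Metric.ball s₀ 1) := by
    refine differentiableOn_tsum_of_summable_norm hu (fun m => ?_) Metric.isOpen_ball
      fun m s hs => hle _ ?_ m
    · simp only [thetaTerm, Pi.add_apply, Pi.smul_apply, smul_eq_mul]
      fun_prop
    · refine (norm_add_le _ _).trans (add_le_add le_rfl ?_)
      rw [norm_smul]
      refine mul_le_mul_of_nonneg_right ?_ (norm_nonneg _)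
      have h1 := norm_add_le s₀ (s - s₀)
      rw [add_sub_cancel] at h1
      have h2 : ‖s - s₀‖ < 1 := by rw [← dist_eq_norm]; exact hs
      linarith
  exact this.differentiableAt (Metric.isOpen_ball.mem_nhds (Metric.mem_ball_self one_pos))

/-- The coefficients of an absolutely convergent multiple Fourier series are determined by its
values. -/
lemma fourier_coeff_eq_zero {g : ℕ} {ι : Type*} {f : ι → Fin g → ℤ} (hf : Function.Injective f)
    {b : ι → ℂ} (hb : Summable fun i => ‖b i‖)
    (h : ∀ x : Fin g → ℝ, ∑' i, b i * exp (2 * Real.pi * I * ∑ j, (f i j : ℂ) * x j) = 0) (k : ι) :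
    b k = 0 := by
  classical
  have hs : Summable fun i => b i • UnitAddTorus.mFourier (f i) := by
    refine Summable.of_norm ?_
    simpa [norm_smul, UnitAddTorus.mFourier_norm] using hb
  have hF : ∑' i, b i • UnitAddTorus.mFourier (f i) = 0 := by
    ext x
    obtain ⟨y, rfl⟩ : ∃ y : Fin g → ℝ, (fun j => (y j : UnitAddCircle)) = x :=
      ⟨fun j => (x j).out, funext fun j => Quotient.out_eq (x j)⟩
    have h1 := ((ContinuousMap.evalCLM ℂ (fun j => (y j : UnitAddCircle))).hasSum
      hs.hasSum).tsum_eq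
    have h2 := h y
    simp only [ContinuousMap.evalCLM_apply] at h1
    rw [← h1, ContinuousMap.zero_apply, ← h2]
    refine tsum_congr fun i => ?_
    simp only [ContinuousMap.smul_apply, UnitAddTorus.mFourier, ContinuousMap.coe_mk,
      fourier_coe_apply, smul_eq_mul, ← Complex.exp_sum, Finset.mul_sum]
    congr 2
    refine Finset.sum_congr rfl fun j _ => ?_
    push_cast
    ring
  let L := ContinuousMap.toLp (E := ℂ) 2
    (MeasureTheory.Measure.pi fun _ : Fin g => (AddCircle.haarAddCircle (T := 1))) ℂ
  have hL := L.hasSum hs.hasSum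
  rw [hF, map_zero] at hL
  have hI := (innerSL ℂ (L (UnitAddTorus.mFourier (f k)))).hasSum hL
  have hO : Orthonormal ℂ fun n => L (UnitAddTorus.mFourier n) :=
    UnitAddTorus.orthonormal_mFourier
  rw [orthonormal_iff_ite] at hO
  have h3 : HasSum (fun i => if i = k then b k else 0) (0 : ℂ) := by
    rw [map_zero] at hI
    refine hI.congr_fun fun i => ?_
    have := hO (f k) (f i)
    simp only [innerSL_apply_apply, map_smul, this, hf.eq_iff]
    by_cases hik : i = k
    · simp [hik]
    · simp [hik, Ne.symm hik]
  exact (hasSum_ite_eq k (b k)).unique h3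

/-- Coordinatewise division with remainder by two on `ℤ^g`. -/
def parityEquiv (g : ℕ) : (Fin g → ℤ) ≃ (Fin g → ℤ) × (Fin g → Fin 2) :=
  (Equiv.piCongrRight fun _ => Int.divModEquiv 2).trans
    (Equiv.arrowProdEquivProdArrow (Fin g) (fun _ => ℤ) fun _ => Fin 2)

lemma parityEquiv_symm_apply {g : ℕ} (q : (Fin g → ℤ) × (Fin g → Fin 2)) (i : Fin g) :
    (parityEquiv g).symm q i = q.1 i * 2 + (q.2 i : ℕ) := rfl

/-- The change of summation variables `(m, n) = (k + l + e, k - l)` with `e ∈ {0,1}^g`. -/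
def sumDiffEquiv (g : ℕ) :
    (Fin g → Fin 2) × ((Fin g → ℤ) × (Fin g → ℤ)) ≃ (Fin g → ℤ) × (Fin g → ℤ) where
  toFun p := (fun i => p.2.1 i + p.2.2 i + (p.1 i : ℕ), fun i => p.2.1 i - p.2.2 i)
  invFun q := ((parityEquiv g (q.1 + q.2)).2,
    ((parityEquiv g (q.1 + q.2)).1, (parityEquiv g (q.1 + q.2)).1 - q.2))
  left_inv := by
    rintro ⟨e, k, l⟩
    have h : (fun i => k i + l i + (e i : ℕ)) + (fun i => k i - l i)
        = (parityEquiv g).symm (k, e) := by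
      funext i
      rw [parityEquiv_symm_apply, Pi.add_apply]
      ring
    simp only [h, Equiv.apply_symm_apply]
    refine Prod.ext rfl (Prod.ext rfl (funext fun i => ?_))
    simp
  right_inv := by
    rintro ⟨m, n⟩
    have h : ∀ i, m i + n i = (parityEquiv g (m + n)).1 i * 2 + ((parityEquiv g (m + n)).2 i : ℕ) := by
      intro i
      rw [← parityEquiv_symm_apply, Equiv.symm_apply_apply, Pi.add_apply]
    refine Prod.ext (funext fun i => ?_) (funext fun i => ?_)
    · have := h i
      simp only [Pi.sub_apply]
      linarith
    · simp

/-- The half-integer characteristic `e/2` attached to `e ∈ {0,1}^g`. -/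
noncomputable def halfChar {g : ℕ} (e : Fin g → Fin 2) : Fin g → ℝ := fun i => ((e i : ℕ) : ℝ) / 2

lemma thetaTerm_mul_thetaTerm {g : ℕ} (B : Matrix (Fin g) (Fin g) ℂ) (v w z a : Fin g → ℂ) :
    thetaTerm B (v + w) (z + a) * thetaTerm B (v - w) (z - a)
      = thetaTerm ((2 : ℝ) • B) v ((2 : ℂ) • z) * thetaTerm ((2 : ℝ) • B) w ((2 : ℂ) • a) := by
  simp only [thetaTerm, ← Complex.exp_add]
  congr 1
  have h1 : (∑ i, (v + w) i * (z + a) i) + (∑ i, (v - w) i * (z - a) i)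
      = (∑ i, v i * ((2 : ℂ) • z) i) + (∑ i, w i * ((2 : ℂ) • a) i) := by
    simp only [← Finset.sum_add_distrib]
    refine Finset.sum_congr rfl fun i _ => ?_
    simp only [Pi.add_apply, Pi.sub_apply, Pi.smul_apply, smul_eq_mul]
    ring
  have h2 : (∑ i, ∑ j, (v + w) i * B i j * (v + w) j) + (∑ i, ∑ j, (v - w) i * B i j * (v - w) j)
      = (∑ i, ∑ j, v i * ((2 : ℝ) • B) i j * v j) + ∑ i, ∑ j, w i * ((2 : ℝ) • B) i j * w j := by
    simp only [← Finset.sum_add_distrib]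
    refine Finset.sum_congr rfl fun i _ => Finset.sum_congr rfl fun j _ => ?_
    simp only [Pi.add_apply, Pi.sub_apply, Matrix.smul_apply, Complex.real_smul]
    push_cast
    ring
  linear_combination (2 * Real.pi * I) * h1 + (Real.pi * I) * h2

lemma posDef_im_two_smul {g : ℕ} {B : Matrix (Fin g) (Fin g) ℂ}
    (hpos : Matrix.PosDef (Matrix.of fun i j => (B i j).im)) :
    Matrix.PosDef (Matrix.of fun i j => (((2 : ℝ) • B) i j).im) := by
  have h := hpos.smul (two_pos : (0 : ℝ) < 2)
  have h2 : (Matrix.of fun i j => (((2 : ℝ) • B) i j).im)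
      = (2 : ℝ) • Matrix.of fun i j => (B i j).im := by
    ext i j
    simp
  rwa [h2]

/-- Riemann's addition formula. -/
lemma riemannTheta_add_mul_riemannTheta_sub {g : ℕ} {B : Matrix (Fin g) (Fin g) ℂ}
    (hpos : Matrix.PosDef (Matrix.of fun i j => (B i j).im)) (z a : Fin g → ℂ) :
    riemannTheta g B (z + a) * riemannTheta g B (z - a)
      = ∑ e : Fin g → Fin 2, thetaLevel2 g B (halfChar e) z * thetaLevel2 g B (halfChar e) a := by
  have hpos2 := posDef_im_two_smul hpos
  simp only [riemannTheta_eq_thetaChar, thetaLevel2_eq_thetaChar]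
  have hs := summable_mul_of_summable_norm (summable_norm_thetaTerm hpos 0 (z + a))
    (summable_norm_thetaTerm hpos 0 (z - a))
  have key : ∀ p : (Fin g → Fin 2) × ((Fin g → ℤ) × (Fin g → ℤ)),
      thetaTerm B (fun i => ((sumDiffEquiv g p).1 i : ℂ) + (0 : Fin g → ℝ) i) (z + a)
        * thetaTerm B (fun i => ((sumDiffEquiv g p).2 i : ℂ) + (0 : Fin g → ℝ) i) (z - a)
      = thetaTerm ((2 : ℝ) • B) (fun i => (p.2.1 i : ℂ) + halfChar p.1 i) ((2 : ℂ) • z)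
        * thetaTerm ((2 : ℝ) • B) (fun i => (p.2.2 i : ℂ) + halfChar p.1 i) ((2 : ℂ) • a) := by
    intro p
    rw [← thetaTerm_mul_thetaTerm]
    congr 2 <;> funext i <;> simp [sumDiffEquiv, halfChar]
    ring
  have hs' : Summable fun p => _ := (sumDiffEquiv g).summable_iff.2 hs
  simp only [Function.comp_apply] at hs'
  rw [thetaChar, thetaChar, tsum_mul_tsum_of_summable_norm (summable_norm_thetaTerm hpos 0 (z + a))
    (summable_norm_thetaTerm hpos 0 (z - a)), ← (sumDiffEquiv g).tsum_eq, hs'.tsum_prod,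
    tsum_fintype]
  refine Finset.sum_congr rfl fun e _ => ?_
  rw [thetaChar, thetaChar, tsum_mul_tsum_of_summable_norm
    (summable_norm_thetaTerm hpos2 _ _) (summable_norm_thetaTerm hpos2 _ _)]
  exact tsum_congr fun q => key (e, q)

lemma thetaTerm_eq_mul_exp {g : ℕ} (B : Matrix (Fin g) (Fin g) ℂ) (v z : Fin g → ℂ) :
    thetaTerm B v z = thetaTerm B v 0 * exp (2 * Real.pi * I * ∑ i, v i * z i) := by
  simp only [thetaTerm, ← Complex.exp_add]
  congr 1
  simp
  ring

/-- The Riemann theta function does not vanish identically. -/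
lemma exists_riemannTheta_ne_zero {g : ℕ} {B : Matrix (Fin g) (Fin g) ℂ}
    (hpos : Matrix.PosDef (Matrix.of fun i j => (B i j).im)) : ∃ z, riemannTheta g B z ≠ 0 := by
  by_contra! h
  have hs := summable_norm_thetaTerm hpos 0 0
  refine Complex.exp_ne_zero _ (fourier_coeff_eq_zero Function.injective_id hs (fun x => ?_) 0)
  rw [← h fun j => (x j : ℂ), riemannTheta_eq_thetaChar, thetaChar]
  refine tsum_congr fun m => ?_
  rw [thetaTerm_eq_mul_exp _ _ fun j => (x j : ℂ)]
  simp

/-- The level two theta functions with half-integer characteristics are linearly independent. -/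
lemma thetaLevel2_coeff_eq_zero {g : ℕ} {B : Matrix (Fin g) (Fin g) ℂ}
    (hpos : Matrix.PosDef (Matrix.of fun i j => (B i j).im)) {c : (Fin g → Fin 2) → ℂ}
    (h : ∀ z, ∑ e, thetaLevel2 g B (halfChar e) z * c e = 0) (e : Fin g → Fin 2) : c e = 0 := by
  have hpos2 := posDef_im_two_smul hpos
  let b : (Fin g → Fin 2) × (Fin g → ℤ) → ℂ := fun q =>
    c q.1 * thetaTerm ((2 : ℝ) • B) (fun i => (q.2 i : ℂ) + halfChar q.1 i) 0
  have hb : Summable fun q => ‖b q‖ := by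
    rw [summable_prod_of_nonneg fun _ => norm_nonneg _]
    refine ⟨fun e => ?_, Summable.of_finite⟩
    simpa only [b, norm_mul] using (summable_norm_thetaTerm hpos2 (halfChar e) 0).mul_left ‖c e‖
  let f : (Fin g → Fin 2) × (Fin g → ℤ) → Fin g → ℤ := fun q => (parityEquiv g).symm q.swap
  have hf : Function.Injective f := (parityEquiv g).symm.injective.comp Prod.swap_injective
  have h0 := fourier_coeff_eq_zero hf hb (fun x => ?_) (e, 0)
  · exact (mul_eq_zero.1 h0).resolve_right (Complex.exp_ne_zero _)
  have hterm : ∀ q, b q * exp (2 * Real.pi * I * ∑ j, (f q j : ℂ) * x j)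
      = thetaTerm ((2 : ℝ) • B) (fun i => (q.2 i : ℂ) + halfChar q.1 i)
          ((2 : ℂ) • fun j => (x j : ℂ)) * c q.1 := by
    intro q
    rw [thetaTerm_eq_mul_exp _ _ ((2 : ℂ) • fun j => (x j : ℂ)), mul_comm (b q), ← mul_assoc]
    have : ∑ j, (f q j : ℂ) * x j
        = ∑ i, ((q.2 i : ℂ) + halfChar q.1 i) * ((2 : ℂ) • fun j => (x j : ℂ)) i := by
      refine Finset.sum_congr rfl fun j _ => ?_
      simp only [f, parityEquiv_symm_apply, halfChar, Pi.smul_apply, smul_eq_mul, Prod.fst_swap,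
        Prod.snd_swap]
      push_cast
      ring
    rw [this]
    ring
  have hsum : Summable fun q => b q * exp (2 * Real.pi * I * ∑ j, (f q j : ℂ) * x j) := by
    refine Summable.of_norm (hb.congr fun q => (?_ : ‖b q‖ = _))
    rw [norm_mul (b q), Complex.norm_exp]
    simp
  rw [hsum.tsum_prod, tsum_fintype, ← h fun j => (x j : ℂ)]
  refine Finset.sum_congr rfl fun e _ => ?_
  rw [thetaLevel2_eq_thetaChar, thetaChar, ← tsum_mul_right]
  exact tsum_congr fun m => hterm (e, m)

lemma differentiable_riemannTheta_line {g : ℕ} {B : Matrix (Fin g) (Fin g) ℂ}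
    (hpos : Matrix.PosDef (Matrix.of fun i j => (B i j).im)) (d z : Fin g → ℂ) :
    Differentiable ℂ fun s : ℂ => riemannTheta g B (z + s • d) := by
  simpa only [riemannTheta_eq_thetaChar] using differentiable_thetaChar_line hpos 0 z d

lemma differentiable_thetaLevel2_line {g : ℕ} {B : Matrix (Fin g) (Fin g) ℂ}
    (hpos : Matrix.PosDef (Matrix.of fun i j => (B i j).im)) (ε : Fin g → ℝ) (d z : Fin g → ℂ) :
    Differentiable ℂ fun s : ℂ => thetaLevel2 g B ε (z + s • d) := by
  have := differentiable_thetaChar_line (posDef_im_two_smul hpos) ε ((2 : ℂ) • z) ((2 : ℂ) • d)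
  simpa only [thetaLevel2_eq_thetaChar, smul_add, smul_comm (2 : ℂ)] using this

section LineDerivatives

variable {g : ℕ} {U : Fin g → ℂ} {f h : (Fin g → ℂ) → ℂ}

lemma dirD_add_smul (U : Fin g → ℂ) (f : (Fin g → ℂ) → ℂ) (w : Fin g → ℂ) (s : ℂ) :
    dirD U f (w + s • U) = deriv (fun r : ℂ => f (w + r • U)) s := by
  have := deriv_comp_const_add (f := fun r : ℂ => f (w + r • U)) s 0
  rw [add_zero] at this
  rw [← this, dirD]
  simp only [add_smul, add_assoc]

lemma differentiable_dirD (hf : ∀ w, Differentiable ℂ fun s : ℂ => f (w + s • U))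
    (w : Fin g → ℂ) : Differentiable ℂ fun s : ℂ => dirD U f (w + s • U) := by
  simp only [dirD_add_smul]
  exact (hf w).deriv

lemma hasDerivAt_line (hf : ∀ w, Differentiable ℂ fun s : ℂ => f (w + s • U))
    (w : Fin g → ℂ) (s : ℂ) :
    HasDerivAt (fun r : ℂ => f (w + r • U)) (dirD U f (w + s • U)) s := by
  rw [dirD_add_smul]
  exact (hf w s).hasDerivAt

/-- Differentiating a product `f(z+a) h(z-a)` in the variable `a`. -/
lemma hasDerivAt_add_mul_sub (hf : ∀ w, Differentiable ℂ fun s : ℂ => f (w + s • U))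
    (hh : ∀ w, Differentiable ℂ fun s : ℂ => h (w + s • U)) (z a : Fin g → ℂ) :
    HasDerivAt (fun s : ℂ => f (z + (a + s • U)) * h (z - (a + s • U)))
      (dirD U f (z + a) * h (z - a) - f (z + a) * dirD U h (z - a)) 0 := by
  have h1 := hasDerivAt_line hf (z + a) 0
  have h2 : HasDerivAt (fun s : ℂ => h (z - a + (-s) • U)) (-dirD U h (z - a)) 0 := by
    have h3 := hasDerivAt_line hh (z - a) (-0)
    simpa [Function.comp_def] using h3.comp (0 : ℂ) (hasDerivAt_neg 0)
  have h4 := h1.mul h2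
  simp only [zero_smul, add_zero, neg_zero] at h4
  convert! h4 using 1
  · funext s
    rw [Pi.mul_apply, neg_smul, ← sub_eq_add_neg, add_assoc, sub_sub]
  · ring

variable {ι : Type*} [Fintype ι] {Θ : ι → (Fin g → ℂ) → ℂ}

/-- The first derivative of an addition formula. -/
lemma addition_formula_dirD (hf : ∀ w, Differentiable ℂ fun s : ℂ => f (w + s • U))
    (hΘ : ∀ e w, Differentiable ℂ fun s : ℂ => Θ e (w + s • U))
    (hadd : ∀ z a, f (z + a) * f (z - a) = ∑ e, Θ e z * Θ e a) (z a : Fin g → ℂ) :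
    dirD U f (z + a) * f (z - a) - f (z + a) * dirD U f (z - a)
      = ∑ e, Θ e z * dirD U (Θ e) a := by
  have h1 := hasDerivAt_add_mul_sub hf hf z a
  simp only [hadd] at h1
  refine h1.unique (HasDerivAt.fun_sum fun e _ => ?_)
  simpa using (hasDerivAt_line (hΘ e) a 0).const_mul (Θ e z)

/-- The second derivative of an addition formula. -/
lemma addition_formula_dirD_dirD (hf : ∀ w, Differentiable ℂ fun s : ℂ => f (w + s • U))
    (hΘ : ∀ e w, Differentiable ℂ fun s : ℂ => Θ e (w + s • U))
    (hadd : ∀ z a, f (z + a) * f (z - a) = ∑ e, Θ e z * Θ e a) (z a : Fin g → ℂ) :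
    dirD U (dirD U f) (z + a) * f (z - a) - 2 * (dirD U f (z + a) * dirD U f (z - a))
        + f (z + a) * dirD U (dirD U f) (z - a)
      = ∑ e, Θ e z * dirD U (dirD U (Θ e)) a := by
  have hf' := differentiable_dirD hf
  have h1 := (hasDerivAt_add_mul_sub hf' hf z a).sub (hasDerivAt_add_mul_sub hf hf' z a)
  have h2 : HasDerivAt (fun s : ℂ => ∑ e, Θ e z * dirD U (Θ e) (a + s • U))
      (∑ e, Θ e z * dirD U (dirD U (Θ e)) a) 0 := by
    refine HasDerivAt.fun_sum fun e _ => ?_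
    simpa using (hasDerivAt_line (differentiable_dirD (hΘ e)) a 0).const_mul (Θ e z)
  have h3 := h2.unique (h1.congr_of_eventuallyEq (Filter.Eventually.of_forall fun s =>
    (addition_formula_dirD hf hΘ hadd z (a + s • U)).symm))
  rw [h3]
  ring

end LineDerivatives

lemma hasDerivAt_exp_affine (p k x : ℂ) :
    HasDerivAt (fun y => exp (p * y + k)) (exp (p * x + k) * p) x := by
  simpa using (((hasDerivAt_id x).const_mul p).add_const k).cexp

lemma deriv_div_mul_exp {F G : ℂ → ℂ} (hF : Differentiable ℂ F) (hG : Differentiable ℂ G)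
    (p k x : ℂ) (hx : G x ≠ 0) :
    deriv (fun y => F y / G y * exp (p * y + k)) x
      = (deriv F x / G x - F x * deriv G x / G x ^ 2 + p * (F x / G x)) * exp (p * x + k) := by
  rw [(((hF x).hasDerivAt.fun_div (hG x).hasDerivAt hx).fun_mul
    (hasDerivAt_exp_affine p k x)).deriv]
  field_simp

lemma deriv_deriv_div_mul_exp {F G : ℂ → ℂ} (hF : Differentiable ℂ F) (hG : Differentiable ℂ G)
    (p k x : ℂ) (hx : G x ≠ 0) :
    deriv (deriv fun y => F y / G y * exp (p * y + k)) x
      = (deriv (deriv F) x / G x - 2 * deriv F x * deriv G x / G x ^ 2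
          - F x * deriv (deriv G) x / G x ^ 2 + 2 * F x * deriv G x ^ 2 / G x ^ 3
          + 2 * p * (deriv F x / G x - F x * deriv G x / G x ^ 2)
          + p ^ 2 * (F x / G x)) * exp (p * x + k) := by
  have hev : (deriv fun y => F y / G y * exp (p * y + k)) =ᶠ[nhds x] fun y =>
      (deriv F y / G y - F y * deriv G y / G y ^ 2 + p * (F y / G y)) * exp (p * y + k) := by
    filter_upwards [hG.continuous.continuousAt.eventually_ne hx] with y hy
    exact deriv_div_mul_exp hF hG p k y hy
  have hF0 := (hF x).hasDerivAt
  have hG0 := (hG x).hasDerivAt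
  have hF1 := (hF.deriv x).hasDerivAt
  have hG1 := (hG.deriv x).hasDerivAt
  rw [hev.deriv_eq, ((((hF1.fun_div hG0 hx).fun_sub ((hF0.fun_mul hG1).fun_div (hG0.fun_pow 2)
    (pow_ne_zero 2 hx))).fun_add ((hF0.fun_div hG0 hx).const_mul p)).fun_mul
    (hasDerivAt_exp_affine p k x)).deriv]
  push_cast
  field_simp
  ring

/-- The heat operator with potential `-2 ∂² log τ` applied to `ψ = (a/τ) e^{px+Et}`, in terms of
Hirota's bilinear operator. -/
lemma heat_operator_eq_bilinear {a₁ τ₁ a₂ τ₂ : ℂ → ℂ} (ha₁ : Differentiable ℂ a₁)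
    (hτ₁ : Differentiable ℂ τ₁) (ha₂ : Differentiable ℂ a₂) (hτ₂ : Differentiable ℂ τ₂)
    (p E x t : ℂ) (ha : a₂ t = a₁ x) (hτ : τ₂ t = τ₁ x) (hx : τ₁ x ≠ 0) :
    deriv (fun s => a₂ s / τ₂ s * exp (p * x + E * s)) t
        - deriv (deriv fun y => a₁ y / τ₁ y * exp (p * y + E * t)) x
        + (-2 * ((deriv (deriv τ₁) x * τ₁ x - deriv τ₁ x ^ 2) / τ₁ x ^ 2))
          * (a₁ x / τ₁ x * exp (p * x + E * t))
      = ((deriv a₂ t * τ₁ x - a₁ x * deriv τ₂ t)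
          - (deriv (deriv a₁) x * τ₁ x - 2 * (deriv a₁ x * deriv τ₁ x) + a₁ x * deriv (deriv τ₁) x)
          - 2 * p * (deriv a₁ x * τ₁ x - a₁ x * deriv τ₁ x)
          + (E - p ^ 2) * (a₁ x * τ₁ x)) * (exp (p * x + E * t) / τ₁ x ^ 2) := by
  simp only [add_comm (p * x) (E * _)]
  rw [deriv_div_mul_exp ha₂ hτ₂ E (p * x) t (hτ ▸ hx),
    deriv_deriv_div_mul_exp ha₁ hτ₁ p (E * t) x hx, ha, hτ, add_comm (p * x)]
  field_simp
  ring

/-- A function, entire along complex lines, that vanishes off the zero set of a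
nonzero such function vanishes everywhere. -/
lemma eq_zero_of_eq_zero_of_ne_zero {g : ℕ} {f h : (Fin g → ℂ) → ℂ}
    (hf : ∀ d w, Differentiable ℂ fun s : ℂ => f (w + s • d))
    (hh : ∀ d w, Differentiable ℂ fun s : ℂ => h (w + s • d))
    (hne : ∃ w, f w ≠ 0) (H : ∀ w, f w ≠ 0 → h w = 0) (w : Fin g → ℂ) : h w = 0 := by
  obtain ⟨w₀, hw₀⟩ := hne
  have h1 := AnalyticOnNhd.eq_zero_or_eq_zero_of_mul_eq_zero (U := Set.univ)
    ((hf (w₀ - w) w).differentiableOn.analyticOnNhd isOpen_univ)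
    ((hh (w₀ - w) w).differentiableOn.analyticOnNhd isOpen_univ)
    (fun s _ => mul_eq_zero.2 (or_iff_not_imp_left.2 fun hs => H _ hs)) isPreconnected_univ
  rcases h1 with h1 | h1
  · exact absurd (by simpa using h1 1 (Set.mem_univ 1)) hw₀
  · simpa using h1 0 (Set.mem_univ 0)

/-- Hirota's bilinear expression of theta functions, expanded in level two theta functions. -/
lemma bilinear_riemannTheta {g : ℕ} {B : Matrix (Fin g) (Fin g) ℂ}
    (hpos : Matrix.PosDef (Matrix.of fun i j => (B i j).im)) (U V A : Fin g → ℂ) (p E : ℂ)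
    (w : Fin g → ℂ) :
    (dirD V (riemannTheta g B) (A + w) * riemannTheta g B w
          - riemannTheta g B (A + w) * dirD V (riemannTheta g B) w)
        - (dirD U (dirD U (riemannTheta g B)) (A + w) * riemannTheta g B w
          - 2 * (dirD U (riemannTheta g B) (A + w) * dirD U (riemannTheta g B) w)
          + riemannTheta g B (A + w) * dirD U (dirD U (riemannTheta g B)) w)
        - 2 * p * (dirD U (riemannTheta g B) (A + w) * riemannTheta g B w
          - riemannTheta g B (A + w) * dirD U (riemannTheta g B) w)
        + (E - p ^ 2) * (riemannTheta g B (A + w) * riemannTheta g B w)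
      = ∑ e : Fin g → Fin 2, thetaLevel2 g B (halfChar e) (w + fun i => A i / 2) *
          (dirD V (thetaLevel2 g B (halfChar e)) (fun i => A i / 2)
            - dirD U (dirD U (thetaLevel2 g B (halfChar e))) (fun i => A i / 2)
            - 2 * p * dirD U (thetaLevel2 g B (halfChar e)) (fun i => A i / 2)
            + (E - p ^ 2) * thetaLevel2 g B (halfChar e) (fun i => A i / 2)) := by
  have hadd := riemannTheta_add_mul_riemannTheta_sub hpos
  have hf := differentiable_riemannTheta_line hpos
  have hΘ := fun d (e : Fin g → Fin 2) w => differentiable_thetaLevel2_line hpos (halfChar e) d w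
  have hV := addition_formula_dirD (hf V) (hΘ V) hadd (w + fun i => A i / 2) fun i => A i / 2
  have hU := addition_formula_dirD (hf U) (hΘ U) hadd (w + fun i => A i / 2) fun i => A i / 2
  have hUU := addition_formula_dirD_dirD (hf U) (hΘ U) hadd (w + fun i => A i / 2) fun i => A i / 2
  have h0 := hadd (w + fun i => A i / 2) fun i => A i / 2
  have h1 : (w + fun i => A i / 2) + (fun i => A i / 2) = A + w := by
    funext i
    simp only [Pi.add_apply]
    ring
  rw [add_sub_cancel_right, h1] at hV hU hUU h0
  rw [hV, hU, hUU, h0, Finset.mul_sum, Finset.mul_sum, ← Finset.sum_sub_distrib,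
    ← Finset.sum_sub_distrib, ← Finset.sum_add_distrib]
  exact Finset.sum_congr rfl fun e _ => by ring

lemma exists_halfChar_eq {g : ℕ} {ε : Fin g → ℝ} (hε : ∀ i, ε i = 0 ∨ ε i = 1 / 2) :
    ∃ e, halfChar e = ε := by
  have : ∀ i, ∃ r : Fin 2, ((r : ℕ) : ℝ) / 2 = ε i := fun i =>
    (hε i).elim (fun h => ⟨0, by simp [h]⟩) fun h => ⟨1, by simp [h]⟩
  choose e he using this
  exact ⟨e, funext he⟩

lemma halfChar_eq_zero_or {g : ℕ} (e : Fin g → Fin 2) (i : Fin g) :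
    halfChar e i = 0 ∨ halfChar e i = 1 / 2 := by
  simp only [halfChar]
  generalize e i = r
  fin_cases r <;> simp

lemma deriv_line_eq_dirD {g : ℕ} (U : Fin g → ℂ) (f : (Fin g → ℂ) → ℂ) (w : Fin g → ℂ) :
    (deriv fun s : ℂ => f (w + s • U)) = fun s : ℂ => dirD U f (w + s • U) :=
  funext fun s => (dirD_add_smul U f w s).symm

/-- For the Riemann theta function of an indecomposable ppav (here: `B`
symmetric with positive definite imaginary part) and `τ(x,t) = θ(Ux+Vt+Z)`, the function
`ψ = (θ(A+Ux+Vt+Z)/θ(Ux+Vt+Z)) e^{px+Et}` satisfies `(∂_t − ∂_x² + u)ψ = 0` with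
`u = −2∂_x² log τ` for all `Z` iff for every half-integer characteristic `ε` one has
`(∂_V − ∂_U² − 2p∂_U + (E − p²))Θ[ε,0](A/2) = 0`. -/
theorem stmt_6
    (g : ℕ) (B : Matrix (Fin g) (Fin g) ℂ)
    (hsym : B.IsSymm)
    (hpos : Matrix.PosDef (Matrix.of fun i j => (B i j).im))
    (U V A : Fin g → ℂ) (p E : ℂ) (hU : U ≠ 0) :
    (∀ Z : Fin g → ℂ, ∀ x t : ℂ,
      riemannTheta g B (fun i => U i * x + V i * t + Z i) ≠ 0 →
      (deriv (fun s => riemannTheta g B (fun i => A i + U i * x + V i * s + Z i)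
            / riemannTheta g B (fun i => U i * x + V i * s + Z i)
            * Complex.exp (p * x + E * s)) t
        - deriv (deriv fun y =>
            riemannTheta g B (fun i => A i + U i * y + V i * t + Z i)
            / riemannTheta g B (fun i => U i * y + V i * t + Z i)
            * Complex.exp (p * y + E * t)) x
        + (-2 * ((deriv (deriv fun y =>
                riemannTheta g B (fun i => U i * y + V i * t + Z i)) x
              * riemannTheta g B (fun i => U i * x + V i * t + Z i)
              - (deriv (fun y =>
                riemannTheta g B (fun i => U i * y + V i * t + Z i)) x) ^ 2)
            / (riemannTheta g B (fun i => U i * x + V i * t + Z i)) ^ 2))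
          * (riemannTheta g B (fun i => A i + U i * x + V i * t + Z i)
            / riemannTheta g B (fun i => U i * x + V i * t + Z i)
            * Complex.exp (p * x + E * t)) = 0))
    ↔
    (∀ ε : Fin g → ℝ, (∀ i, ε i = 0 ∨ ε i = 1 / 2) →
      dirD V (thetaLevel2 g B ε) (fun i => A i / 2)
        - dirD U (dirD U (thetaLevel2 g B ε)) (fun i => A i / 2)
        - 2 * p * dirD U (thetaLevel2 g B ε) (fun i => A i / 2)
        + (E - p ^ 2) * thetaLevel2 g B ε (fun i => A i / 2) = 0) := by
  have hf := differentiable_riemannTheta_line hpos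
  let c : (Fin g → Fin 2) → ℂ := fun e =>
    dirD V (thetaLevel2 g B (halfChar e)) (fun i => A i / 2)
      - dirD U (dirD U (thetaLevel2 g B (halfChar e))) (fun i => A i / 2)
      - 2 * p * dirD U (thetaLevel2 g B (halfChar e)) (fun i => A i / 2)
      + (E - p ^ 2) * thetaLevel2 g B (halfChar e) (fun i => A i / 2)
  calc
    _ ↔ ∀ (Z : Fin g → ℂ) (x t : ℂ), riemannTheta g B (fun i => U i * x + V i * t + Z i) ≠ 0 →
        ∑ e, thetaLevel2 g B (halfChar e)
          ((fun i => U i * x + V i * t + Z i) + fun i => A i / 2) * c e = 0 := by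
      refine forall_congr' fun Z => forall_congr' fun x => forall_congr' fun t =>
        forall_congr' fun hne => ?_
      have ha₁ : (fun y => riemannTheta g B (fun i => A i + U i * y + V i * t + Z i))
          = fun y => riemannTheta g B ((fun i => A i + V i * t + Z i) + y • U) := by
        funext y
        congr 1
        funext i
        simp only [Pi.add_apply, Pi.smul_apply, smul_eq_mul]
        ring
      have hτ₁ : (fun y => riemannTheta g B (fun i => U i * y + V i * t + Z i))
          = fun y => riemannTheta g B ((fun i => V i * t + Z i) + y • U) := by
        funext y
        congr 1
        funext i
        simp only [Pi.add_apply, Pi.smul_apply, smul_eq_mul]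
        ring
      have ha₂ : (fun s => riemannTheta g B (fun i => A i + U i * x + V i * s + Z i))
          = fun s => riemannTheta g B ((fun i => A i + U i * x + Z i) + s • V) := by
        funext y
        congr 1
        funext i
        simp only [Pi.add_apply, Pi.smul_apply, smul_eq_mul]
        ring
      have hτ₂ : (fun s => riemannTheta g B (fun i => U i * x + V i * s + Z i))
          = fun s => riemannTheta g B ((fun i => U i * x + Z i) + s • V) := by
        funext y
        congr 1
        funext i
        simp only [Pi.add_apply, Pi.smul_apply, smul_eq_mul]
        ring
      have h := heat_operator_eq_bilinear
        (a₁ := fun y => riemannTheta g B (fun i => A i + U i * y + V i * t + Z i))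
        (τ₁ := fun y => riemannTheta g B (fun i => U i * y + V i * t + Z i))
        (a₂ := fun s => riemannTheta g B (fun i => A i + U i * x + V i * s + Z i))
        (τ₂ := fun s => riemannTheta g B (fun i => U i * x + V i * s + Z i))
        (ha₁ ▸ hf _ _) (hτ₁ ▸ hf _ _) (ha₂ ▸ hf _ _) (hτ₂ ▸ hf _ _) p E x t rfl rfl hne
      refine (Eq.congr_left h).trans ?_
      rw [mul_eq_zero, or_iff_left (div_ne_zero (Complex.exp_ne_zero _) (pow_ne_zero 2 hne)),
        ← bilinear_riemannTheta hpos U V A p E]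
      have eA : (A + fun i => U i * x + V i * t + Z i)
          = fun i => A i + U i * x + V i * t + Z i := by
        funext i
        simp only [Pi.add_apply]
        ring
      have e1 : (fun i => A i + V i * t + Z i) + x • U
          = fun i => A i + U i * x + V i * t + Z i := by
        funext i
        simp only [Pi.add_apply, Pi.smul_apply, smul_eq_mul]
        ring
      have e2 : (fun i => V i * t + Z i) + x • U = fun i => U i * x + V i * t + Z i := by
        funext i
        simp only [Pi.add_apply, Pi.smul_apply, smul_eq_mul]
        ring
      have e3 : (fun i => A i + U i * x + Z i) + t • V
          = fun i => A i + U i * x + V i * t + Z i := by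
        funext i
        simp only [Pi.add_apply, Pi.smul_apply, smul_eq_mul]
        ring
      have e4 : (fun i => U i * x + Z i) + t • V = fun i => U i * x + V i * t + Z i := by
        funext i
        simp only [Pi.add_apply, Pi.smul_apply, smul_eq_mul]
        ring
      simp only [ha₁, hτ₁, ha₂, hτ₂, deriv_line_eq_dirD, eA, e1, e2, e3, e4]
    _ ↔ ∀ e, c e = 0 := by
      refine ⟨fun H => thetaLevel2_coeff_eq_zero hpos fun z => ?_, fun H Z x t _ => by simp [H]⟩
      have h0 := eq_zero_of_eq_zero_of_ne_zero (f := riemannTheta g B)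
        (h := fun w => ∑ e, thetaLevel2 g B (halfChar e) (w + fun i => A i / 2) * c e) hf
        (fun d w => ?_) (exists_riemannTheta_ne_zero hpos) (fun w hw => ?_)
        (z - fun i => A i / 2)
      · simpa using h0
      · refine Differentiable.fun_sum fun e _ => Differentiable.mul_const ?_ _
        simpa only [add_right_comm] using
          differentiable_thetaLevel2_line hpos (halfChar e) d (w + fun i => A i / 2)
      · simpa using H w 0 0 (by simpa using hw)
    _ ↔ _ := by
      refine ⟨fun H ε hε => ?_, fun H e => H _ (halfChar_eq_zero_or e)⟩
      obtain ⟨e, rfl⟩ := exists_halfChar_eq hε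
      exact H e
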